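/- Let q ∈ ℂ, q ≠ 0, d = q + q⁻¹, and let n ≥ 1. Assume the quantum integers [k]_q are nonzero for all 1 ≤ k ≤ n. Let f_n ∈ TL_n(d) be the Jones–Wenzl idempotent defined by f_1 = 1 and f_{k+1} = f_k − ([k]_q/[k+1]_q)·f_k·h_k·f_k, and let Tr_n be the Markov trace on TL_n(d). Then Tr_n(f_n) = [n+1]_q. -/

import Mathlib

/-- The Temperley-Lieb relations on the free algebra on `m` generators
`h_1, …, h_m` (0-indexed as `FreeAlgebra.ι ℂ i`, `i : Fin m`, standing for `h_{i+1}`):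
`h_i² = d·h_i`, `h_i h_j = h_j h_i` for `|i−j| ≥ 2`, and `h_i h_{i±1} h_i = h_i`. -/
inductive TLRel (d : ℂ) (m : ℕ) :
    FreeAlgebra ℂ (Fin m) → FreeAlgebra ℂ (Fin m) → Prop
  | sq (i : Fin m) :
      TLRel d m (FreeAlgebra.ι ℂ i * FreeAlgebra.ι ℂ i) (d • FreeAlgebra.ι ℂ i)
  | comm (i j : Fin m) (h : (i : ℕ) + 2 ≤ (j : ℕ) ∨ (j : ℕ) + 2 ≤ (i : ℕ)) :
      TLRel d m (FreeAlgebra.ι ℂ i * FreeAlgebra.ι ℂ j)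
        (FreeAlgebra.ι ℂ j * FreeAlgebra.ι ℂ i)
  | hook (i j : Fin m) (h : (i : ℕ) + 1 = (j : ℕ) ∨ (j : ℕ) + 1 = (i : ℕ)) :
      TLRel d m (FreeAlgebra.ι ℂ i * FreeAlgebra.ι ℂ j * FreeAlgebra.ι ℂ i)
        (FreeAlgebra.ι ℂ i)

/-- The Temperley-Lieb algebra `TL_n(d)`: the unital associative `ℂ`-algebra with
generators `h_1, …, h_{n−1}` and the Temperley-Lieb relations, realized as a
`RingQuot` of the free algebra on `n − 1` generators. -/
abbrev TL (d : ℂ) (n : ℕ) : Type := RingQuot (TLRel d (n - 1))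

/-- The generator of `TL_n(d)` indexed by `i : Fin (n-1)` (representing `h_{i+1}`). -/
noncomputable def TLgen (d : ℂ) (n : ℕ) (i : Fin (n - 1)) : TL d n :=
  RingQuot.mkAlgHom ℂ (TLRel d (n - 1)) (FreeAlgebra.ι ℂ i)

/-- The generator `h_i` of `TL_n(d)` in its 1-based labelling (`1 ≤ i ≤ n−1`),
with junk value `0` outside that range. -/
noncomputable def TLh (d : ℂ) (n : ℕ) (i : ℕ) : TL d n :=
  if h : 1 ≤ i ∧ i ≤ n - 1 then TLgen d n ⟨i - 1, by omega⟩ else 0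

/-- The quantum integer `[k]_q`, equal to `(q^k − q^{−k})/(q − q^{−1})` when `q² ≠ 1`
and to `k·q^{k−1}` when `q = ±1`. -/
noncomputable def qInt (q : ℂ) (k : ℕ) : ℂ :=
  if q ^ 2 = 1 then (k : ℂ) * q ^ (k - 1) else (q ^ k - q⁻¹ ^ k) / (q - q⁻¹)


/-- Jones–Wenzl recursion in an arbitrary algebra. -/
noncomputable def JWaux {A : Type} [Ring A] [Algebra ℂ A] (c : ℕ → ℂ) (h : ℕ → A) : ℕ → A
  | 0 => 1
  | k + 1 => JWaux c h k - c k • (JWaux c h k * h k * JWaux c h k)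

theorem JWaux_comm {A : Type} [Ring A] [Algebra ℂ A] (c : ℕ → ℂ) (h : ℕ → A)
    (hcomm : ∀ i j, i + 2 ≤ j → h j * h i = h i * h j) (k : ℕ) :
    ∀ j, k + 1 ≤ j → Commute (h j) (JWaux c h k) := by
  induction k with
  | zero => intro j _; exact Commute.one_right _
  | succ k ih =>
    intro j hj
    have h1 := ih j (by omega)
    have h2 : Commute (h j) (h k) := hcomm k j (by omega)
    exact h1.sub_right (((h1.mul_right h2).mul_right h1).smul_right _)

theorem JWaux_idem {A : Type} [Ring A] [Algebra ℂ A] (d : ℂ) (c : ℕ → ℂ) (h : ℕ → A)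
    (N : ℕ) (h0 : h 0 = 0)
    (hcomm : ∀ i j, i + 2 ≤ j → h j * h i = h i * h j)
    (hsq : ∀ i, h i * h i = d • h i)
    (hhook : ∀ i, 1 ≤ i → i + 1 ≤ N → h (i + 1) * h i * h (i + 1) = h (i + 1))
    (hc0 : c 0 = 0)
    (hc : ∀ k, k + 1 ≤ N → c (k + 1) * (d - c k) = 1) (k : ℕ) :
    k ≤ N + 1 → JWaux c h k * JWaux c h k = JWaux c h k ∧
      (JWaux c h k * JWaux c h (k + 1) = JWaux c h (k + 1)) ∧
      (k + 1 ≤ N → h (k + 1) * JWaux c h (k + 1) * h (k + 1)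
        = (d - c k) • (h (k + 1) * JWaux c h k)) := by
  have hmul : ∀ k, JWaux c h k * JWaux c h k = JWaux c h k →
      JWaux c h k * JWaux c h (k + 1) = JWaux c h (k + 1) := by
    intro k hk
    simp only [JWaux, mul_sub, mul_smul_comm, ← mul_assoc, hk]
  have hmid : ∀ k, k + 1 ≤ N → JWaux c h k * JWaux c h k = JWaux c h k →
      h (k + 1) * JWaux c h (k + 1) * h (k + 1)
        = (d - c k) • (h (k + 1) * JWaux c h k) := by
    intro k hkN hk
    have hcm : h (k + 1) * JWaux c h k = JWaux c h k * h (k + 1) :=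
      JWaux_comm c h hcomm k (k + 1) le_rfl
    rcases Nat.eq_zero_or_pos k with rfl | hpos
    · simp [JWaux, hc0, hsq]
    · have e1 : h (k + 1) * JWaux c h k * h (k + 1) = d • (h (k + 1) * JWaux c h k) := by
        rw [hcm, mul_assoc, hsq, mul_smul_comm]
      have e2 : h (k + 1) * (JWaux c h k * h k * JWaux c h k) * h (k + 1)
          = h (k + 1) * JWaux c h k := by
        calc _ = (h (k + 1) * JWaux c h k) * h k * (JWaux c h k * h (k + 1)) := by
              simp only [mul_assoc]
          _ = JWaux c h k * (h (k + 1) * h k * h (k + 1)) * JWaux c h k := by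
              rw [← hcm, hcm, ← hcm]
              nth_rewrite 1 [hcm]
              simp only [mul_assoc]
          _ = _ := by rw [hhook k hpos hkN, ← hcm, mul_assoc, hk]
      simp only [JWaux, mul_sub, sub_mul, mul_smul_comm, smul_mul_assoc, e1, e2, sub_smul]
  induction k using Nat.strong_induction_on with
  | _ k ih =>
    intro hkN
    have : JWaux c h k * JWaux c h k = JWaux c h k := by
      rcases k with _ | _ | j
      · simp [JWaux]
      · simp [JWaux, hc0]
      · have i0 := (ih (j + 1) (by omega) (by omega)).1
        obtain ⟨_, i2, i3⟩ := ih j (by omega) (by omega)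
        have i3 := i3 (by omega)
        have hcj := hc j (by omega)
        rw [show JWaux c h (j + 1 + 1) = JWaux c h (j + 1)
          - c (j + 1) • (JWaux c h (j + 1) * h (j + 1) * JWaux c h (j + 1)) from rfl]
        generalize JWaux c h (j + 1) = F at *
        generalize JWaux c h j = G at *
        have e : (F * h (j + 1) * F) * (F * h (j + 1) * F)
            = (d - c j) • (F * h (j + 1) * F) := by
          calc _ = F * (h (j + 1) * (F * F) * h (j + 1)) * F := by simp only [mul_assoc]
            _ = _ := by
              rw [i0, i3, mul_smul_comm, smul_mul_assoc]
              simp only [mul_assoc, i2]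
        have e1 : F * (F * h (j + 1) * F) = F * h (j + 1) * F := by
          simp only [← mul_assoc, i0]
        have e2 : (F * h (j + 1) * F) * F = F * h (j + 1) * F := by
          simp only [mul_assoc, i0]
        rw [sub_mul, mul_sub, mul_sub, mul_smul_comm, smul_mul_assoc, smul_mul_assoc,
          mul_smul_comm, e, e1, e2, i0, smul_smul (c (j + 1)) (d - c j), hcj, one_smul, sub_self,
          sub_zero]
    exact ⟨this, hmul _ this, fun hN => hmid _ hN this⟩

theorem qInt_rec (q : ℂ) (hq : q ≠ 0) (k : ℕ) :
    qInt q (k + 2) = (q + q⁻¹) * qInt q (k + 1) - qInt q k := by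
  unfold qInt
  split_ifs with h
  · have hinv : q⁻¹ = q := by field_simp; exact h.symm
    rw [hinv]
    rcases k with _ | k
    · simp; ring
    · simp only [Nat.add_sub_cancel, show k + 1 + 2 - 1 = k + 2 by omega]
      push_cast
      have e : q ^ (k+2) = q ^ k := by rw [pow_add, h, mul_one]
      have e' : (q + q) * (((k:ℂ) + 1 + 1) * q ^ (k+1)) = 2 * (k + 2) * q ^ (k+2) := by ring
      rw [e', e]; ring
  · have h2 : q - q⁻¹ ≠ 0 := by
      intro h3
      apply h
      field_simp at h3
      linear_combination h3
    rw [div_eq_iff h2, sub_mul, mul_assoc, div_mul_cancel₀ _ h2, div_mul_cancel₀ _ h2]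
    have : q * q⁻¹ = 1 := mul_inv_cancel₀ hq
    linear_combination (-q^k + q⁻¹^k) * this

theorem qInt_zero (q : ℂ) : qInt q 0 = 0 := by simp [qInt]

theorem qInt_one (q : ℂ) (hq : q ≠ 0) : qInt q 1 = 1 := by
  unfold qInt
  split_ifs with h
  · simp
  · have h2 : q - q⁻¹ ≠ 0 := by
      intro h3
      apply h
      field_simp at h3
      linear_combination h3
    simp [div_self h2]

theorem TLgen_rel (d : ℂ) (n : ℕ) (a b : FreeAlgebra ℂ (Fin (n - 1)))
    (h : TLRel d (n - 1) a b) :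
    RingQuot.mkAlgHom ℂ (TLRel d (n - 1)) a = RingQuot.mkAlgHom ℂ (TLRel d (n - 1)) b :=
  RingQuot.mkAlgHom_rel ℂ h

theorem TLh_zero (d : ℂ) (n : ℕ) : TLh d n 0 = 0 := by simp [TLh]

theorem TLh_sq (d : ℂ) (n i : ℕ) : TLh d n i * TLh d n i = d • TLh d n i := by
  unfold TLh
  split_ifs with h
  · have := TLgen_rel d n _ _ (TLRel.sq ⟨i - 1, by omega⟩)
    simpa only [TLgen, map_mul, map_smul] using this
  · simp

theorem TLh_comm (d : ℂ) (n i j : ℕ) (hij : i + 2 ≤ j) :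
    TLh d n j * TLh d n i = TLh d n i * TLh d n j := by
  unfold TLh
  split_ifs with h h'
  · have := TLgen_rel d n _ _ (TLRel.comm ⟨j - 1, by omega⟩ ⟨i - 1, by omega⟩
      (by right; simp only; omega))
    simpa only [TLgen, map_mul] using this
  all_goals simp

theorem TLh_hook (d : ℂ) (n i : ℕ) (hi : 1 ≤ i) (hn : i + 1 ≤ n - 1) :
    TLh d n (i + 1) * TLh d n i * TLh d n (i + 1) = TLh d n (i + 1) := by
  unfold TLh
  rw [dif_pos ⟨by omega, hn⟩, dif_pos ⟨hi, by omega⟩]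
  have := TLgen_rel d n _ _ (TLRel.hook ⟨i + 1 - 1, by omega⟩ ⟨i - 1, by omega⟩
      (by right; simp only; omega))
  simpa only [TLgen, map_mul] using this

/-- Let `q ∈ ℂ`, `q ≠ 0`, `d = q + q⁻¹`, `n ≥ 1`, and assume `[k]_q ≠ 0` for
`1 ≤ k ≤ n`.  Let `f n ∈ TL_n(d)` be the Jones–Wenzl idempotent, defined by `f 1 = 1`
and the Wenzl recursion, and let `T` be the Markov trace family, characterized by
`Tr_1(1) = d`, `Tr_{m+1}(ι_m(x)) = d·Tr_m(x)` and
`Tr_{m+1}(ι_m(x)·h_m·ι_m(y)) = Tr_m(x·y)`, where `ι_m : TL_m(d) → TL_{m+1}(d)` sends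
`h_i` to `h_i`.  Then `Tr_n(f_n) = [n+1]_q`. -/
theorem stmt12 (q : ℂ) (hq : q ≠ 0) (n : ℕ) (hn : 1 ≤ n)
    (hk : ∀ k : ℕ, 1 ≤ k → k ≤ n → qInt q k ≠ 0)
    (ι : ∀ m : ℕ, TL (q + q⁻¹) m →ₐ[ℂ] TL (q + q⁻¹) (m + 1))
    (hι : ∀ (m : ℕ) (i : Fin (m - 1)),
      ι m (TLgen (q + q⁻¹) m i) = TLgen (q + q⁻¹) (m + 1) (Fin.castLE (by omega) i))
    (T : ∀ m : ℕ, TL (q + q⁻¹) m →ₗ[ℂ] ℂ)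
    (hT1 : T 1 1 = q + q⁻¹)
    (hT2 : ∀ m : ℕ, 1 ≤ m → ∀ x : TL (q + q⁻¹) m,
      T (m + 1) (ι m x) = (q + q⁻¹) * T m x)
    (hT3 : ∀ m : ℕ, 1 ≤ m → ∀ x y : TL (q + q⁻¹) m,
      T (m + 1) (ι m x * TLh (q + q⁻¹) (m + 1) m * ι m y) = T m (x * y))
    (f : ℕ → TL (q + q⁻¹) n) (hf1 : f 1 = 1)
    (hfrec : ∀ k : ℕ, 1 ≤ k → k ≤ n - 1 →
      f (k + 1) = f k - (qInt q k / qInt q (k + 1)) •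
        (f k * TLh (q + q⁻¹) n k * f k)) :
    T n (f n) = qInt q (n + 1) := by
  have hι' : ∀ m i, i + 1 ≤ m → ι m (TLh (q + q⁻¹) m i) = TLh (q + q⁻¹) (m + 1) i := by
    intro m i hi
    rcases Nat.eq_zero_or_pos i with rfl | hpos
    · simp [TLh_zero]
    · unfold TLh
      rw [dif_pos ⟨hpos, by omega⟩, dif_pos ⟨hpos, by omega⟩, hι]
      rfl
  set c : ℕ → ℂ := fun k => qInt q k / qInt q (k + 1) with hc
  have hc0 : c 0 = 0 := by simp [hc, qInt_zero]
  have hJι : ∀ m k, k ≤ m → ι m (JWaux c (TLh (q + q⁻¹) m) k)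
      = JWaux c (TLh (q + q⁻¹) (m + 1)) k := by
    intro m k
    induction k with
    | zero => intro _; simp [JWaux]
    | succ k ih =>
      intro hkm
      simp only [JWaux, map_sub, map_smul, map_mul, ih (by omega), hι' m k hkm]
  have hcd : ∀ k, k + 1 ≤ n → (q + q⁻¹) - c k = qInt q (k + 2) / qInt q (k + 1) := by
    intro k hkn
    have := hk (k + 1) (by omega) hkn
    rw [qInt_rec q hq, hc]
    field_simp
  have hidem : ∀ m, m ≤ n → JWaux c (TLh (q + q⁻¹) m) m * JWaux c (TLh (q + q⁻¹) m) m
      = JWaux c (TLh (q + q⁻¹) m) m := by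
    intro m hm
    refine (JWaux_idem (q + q⁻¹) c (TLh (q + q⁻¹) m) (m - 1) (TLh_zero _ _) (TLh_comm _ _)
      (TLh_sq _ _) (TLh_hook _ _) hc0 ?_ m (by omega)).1
    intro k hkm
    have h1 := hk (k + 1) (by omega) (by omega)
    have h2 := hk (k + 2) (by omega) (by omega)
    rw [hcd k (by omega)]
    simp only [hc]
    field_simp
  have hfJ : ∀ k, 1 ≤ k → k ≤ n → f k = JWaux c (TLh (q + q⁻¹) n) k := by
    intro k hk1
    induction k, hk1 using Nat.le_induction with
    | base => intro _; simp [hf1, JWaux, hc0]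
    | succ k hk1 ih =>
      intro hkn
      rw [hfrec k hk1 (by omega), ih (by omega)]
      rfl
  have htr : ∀ m, 1 ≤ m → m ≤ n → T m (JWaux c (TLh (q + q⁻¹) m) m) = qInt q (m + 1) := by
    intro m hm1
    induction m, hm1 using Nat.le_induction with
    | base =>
      intro _
      rw [qInt_rec q hq 0, qInt_zero, qInt_one q hq]
      simp [JWaux, hc0, hT1]
    | succ m hm1 ih =>
      intro hmn
      have ih := ih (by omega)
      have h1 := hk (m + 1) (by omega) hmn
      have e : JWaux c (TLh (q + q⁻¹) (m + 1)) (m + 1)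
          = ι m (JWaux c (TLh (q + q⁻¹) m) m) - c m • (ι m (JWaux c (TLh (q + q⁻¹) m) m)
            * TLh (q + q⁻¹) (m + 1) m * ι m (JWaux c (TLh (q + q⁻¹) m) m)) := by
        rw [hJι m m le_rfl]; rfl
      rw [e, map_sub, map_smul, hT2 m hm1, hT3 m hm1, hidem m (by omega), ih, smul_eq_mul,
        ← sub_mul, hcd m hmn, div_mul_cancel₀ _ h1]
  rw [hfJ n hn le_rfl]
  exact htr n hn le_rfl
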